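/- Assume d is a power of a prime and Ω ⊂ ℤ_d with |Ω| = L. Then for every circular convolution operator A ∈ 𝒜_L the family Y = {e_i, A e_i, …, A^{N_A−1} e_i : i ∈ Ω} is a frame for ℓ²(ℤ_d) if and only if Ω is uniformly distributed over the divisors of d. -/

import Mathlib

open Matrix

/-- Unnormalized discrete Fourier transform of `a : ZMod d → ℂ`. -/
noncomputable def hatKer (d : ℕ) [NeZero d] (a : ZMod d → ℂ) : ZMod d → ℂ :=
  fun j => ∑ k : ZMod d,
    a k * Complex.exp (-(2 * (Real.pi : ℂ) * Complex.I) * ((j.val : ℂ) * (k.val : ℂ)) / (d : ℂ))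

/-- The circular convolution operator with kernel `a`, as a matrix. -/
def convMat (d : ℕ) (a : ZMod d → ℂ) : Matrix (ZMod d) (ZMod d) ℂ :=
  Matrix.of fun k i => a (k - i)

/-- The normalized discrete Fourier matrix `F_d`. -/
noncomputable def FdMat (d : ℕ) : Matrix (ZMod d) (ZMod d) ℂ :=
  Matrix.of fun j k =>
    ((Real.sqrt d : ℝ) : ℂ)⁻¹ *
      Complex.exp (-(2 * (Real.pi : ℂ) * Complex.I) * ((j.val : ℂ) * (k.val : ℂ)) / (d : ℂ))

/-- The largest geometric multiplicity of an eigenvalue of `diag b`, i.e. the size of the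
largest level set of `b`. -/
noncomputable def maxMult (d : ℕ) [NeZero d] (b : ZMod d → ℂ) : ℕ :=
  Finset.univ.sup fun j : ZMod d => Nat.card {t : ZMod d | b t = b j}

/-- The number of distinct eigenvalues of `diag b`. -/
noncomputable def numEig (d : ℕ) [NeZero d] (b : ZMod d → ℂ) : ℕ :=
  Nat.card (Set.range b)

/-- `Ω ⊂ ℤ_d` is uniformly distributed over the divisors of `d`: for every divisor `m`
of `d`, each of the `m` cosets of the subgroup generated by `m` meets `Ω` in a set of
size `⌊|Ω|/m⌋` or `⌈|Ω|/m⌉`. -/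
def UnifDist (d : ℕ) (Ω : Finset (ZMod d)) : Prop :=
  ∀ m : ℕ, m ∣ d → ∀ c : ZMod d,
    {x : ZMod d | x ∈ Ω ∧ x - c ∈ AddSubgroup.zmultiples ((m : ZMod d))}.ncard = Ω.card / m
    ∨ {x : ZMod d | x ∈ Ω ∧ x - c ∈ AddSubgroup.zmultiples ((m : ZMod d))}.ncard
        = (Ω.card + m - 1) / m

/-- The additive character `x ↦ exp(-2πi x / d)`. -/
noncomputable def chiD (d : ℕ) [NeZero d] (x : ZMod d) : ℂ := ZMod.stdAddChar (-x)

section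
variable {d : ℕ} [NeZero d]

lemma chiD_add (x y : ZMod d) : chiD d (x + y) = chiD d x * chiD d y := by
  rw [chiD, neg_add, AddChar.map_add_eq_mul, chiD, chiD]

lemma chiD_zero : chiD d 0 = 1 := by simp [chiD]

lemma chiD_ne_zero (x : ZMod d) : chiD d x ≠ 0 := by
  intro h
  have := chiD_add x (-x)
  rw [add_neg_cancel, chiD_zero, h, zero_mul] at this
  exact one_ne_zero this

lemma chiD_nat_mul (n : ℕ) (x : ZMod d) : chiD d (n * x) = chiD d x ^ n := by
  induction n with
  | zero => simp [chiD_zero]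
  | succ n ih => rw [pow_succ, ← ih, ← chiD_add]; push_cast; ring_nf

lemma chiD_eq_one {x : ZMod d} : chiD d x = 1 ↔ x = 0 := by
  constructor
  · intro h
    rw [← chiD_zero (d := d)] at h
    simpa using ZMod.injective_stdAddChar h
  · rintro rfl
    exact chiD_zero

lemma chiD_one_prim : IsPrimitiveRoot (chiD d 1) d := by
  constructor
  · rw [← chiD_nat_mul]; simp [chiD_zero]
  · intro l hl
    rw [← chiD_nat_mul, chiD_eq_one, mul_one] at hl
    exact (ZMod.natCast_eq_zero_iff _ _).1 hl

lemma dft_chiD (u : ZMod d → ℂ) (k : ZMod d) : ZMod.dft u k = ∑ j, chiD d (j * k) * u j := by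
  simp only [ZMod.dft_apply, chiD, smul_eq_mul]

lemma hatKer_eq (a : ZMod d → ℂ) : hatKer d a = ZMod.dft a := by
  ext j
  rw [dft_chiD, hatKer]
  refine Finset.sum_congr rfl fun k _ => ?_
  rw [mul_comm]
  congr 1
  have h : -(k * j) = ((-(k.val * j.val : ℤ) : ℤ) : ZMod d) := by
    push_cast
    simp
  rw [chiD, h, ZMod.stdAddChar_coe]
  congr 1
  push_cast
  ring

lemma dft_vecMul (a u : ZMod d → ℂ) :
    (ZMod.dft u) ᵥ* convMat d a = ZMod.dft (fun j => hatKer d a j * u j) := by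
  ext k
  rw [dft_chiD, hatKer_eq]
  simp only [vecMul, dotProduct, convMat, of_apply, dft_chiD, Finset.sum_mul, Finset.mul_sum]
  rw [Finset.sum_comm]
  refine Finset.sum_congr rfl fun j _ => ?_
  rw [← Equiv.sum_comp (Equiv.addRight k)]
  refine Finset.sum_congr rfl fun l _ => ?_
  simp only [Equiv.coe_addRight, add_sub_cancel_right]
  rw [mul_add, chiD_add, mul_comm l j]
  ring

lemma dft_vecMul_pow (a u : ZMod d → ℂ) (n : ℕ) :
    (ZMod.dft u) ᵥ* (convMat d a) ^ n = ZMod.dft (fun j => hatKer d a j ^ n * u j) := by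
  induction n with
  | zero => simp
  | succ n ih =>
    rw [pow_succ, ← vecMul_vecMul, ih, dft_vecMul]
    congr 1
    ext j
    ring

lemma span_top_iff (S : Set (ZMod d → ℂ)) :
    Submodule.span ℂ S = ⊤ ↔ ∀ w : ZMod d → ℂ, (∀ v ∈ S, w ⬝ᵥ v = 0) → w = 0 := by
  constructor
  · intro h w hw
    have : Submodule.span ℂ S ≤ LinearMap.ker (dotProductBilin ℂ ℂ w) := by
      rw [Submodule.span_le]
      intro v hv
      exact hw v hv
    rw [h, top_le_iff] at this
    ext k
    have hk : (Pi.single k 1 : ZMod d → ℂ) ∈ LinearMap.ker (dotProductBilin ℂ ℂ w) := by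
      rw [this]; trivial
    simpa using hk
  · intro h
    by_contra hne
    obtain ⟨f, hf, hle⟩ := Submodule.exists_le_ker_of_lt_top _ (lt_top_iff_ne_top.2 hne)
    have hfv : ∀ v, f v = (fun k => f (Pi.single k 1)) ⬝ᵥ v := by
      intro v
      conv_lhs => rw [pi_eq_sum_univ' v]
      simp only [map_sum, map_smul, dotProduct, smul_eq_mul]
      refine Finset.sum_congr rfl fun k _ => ?_
      rw [mul_comm]
    have h0 := h (fun k => f (Pi.single k 1)) (fun v hv => by
      rw [← hfv]
      exact hle (Submodule.subset_span hv))
    apply hf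
    refine LinearMap.ext fun v => ?_
    rw [hfv, h0, zero_dotProduct, LinearMap.zero_apply]

lemma frame_iff (a : ZMod d → ℂ) (Ω : Finset (ZMod d)) (N : ℕ) :
    Submodule.span ℂ {v : ZMod d → ℂ | ∃ i ∈ Ω, ∃ n < N,
          v = (convMat d a) ^ n *ᵥ (Pi.single i 1 : ZMod d → ℂ)} = ⊤ ↔
    ∀ u : ZMod d → ℂ, (∀ i ∈ Ω, ∀ n < N, ∑ j, chiD d (j * i) * (hatKer d a j ^ n * u j) = 0) →
      u = 0 := by
  have key : ∀ (u : ZMod d → ℂ) i n, ZMod.dft u ⬝ᵥ ((convMat d a) ^ n *ᵥ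
      (Pi.single i 1 : ZMod d → ℂ)) = ∑ j, chiD d (j * i) * (hatKer d a j ^ n * u j) := by
    intro u i n
    rw [dotProduct_mulVec, dft_vecMul_pow, dotProduct_single, mul_one, dft_chiD]
  rw [span_top_iff]
  constructor
  · intro h u hu
    have := h (ZMod.dft u) (by
      rintro v ⟨i, hi, n, hn, rfl⟩
      rw [key, hu i hi n hn])
    simpa using this
  · intro h w hw
    obtain ⟨u, rfl⟩ := ZMod.dft.surjective w
    rw [h u fun i hi n hn => ?_, map_zero]
    rw [← key]
    exact hw _ ⟨i, hi, n, hn, rfl⟩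

lemma mem_zmult_iff {m : ℕ} (hm : m ∣ d) (x c : ZMod d) :
    x - c ∈ AddSubgroup.zmultiples ((m : ZMod d)) ↔ x.val % m = c.val % m := by
  have hx : x - c = ((x.val - c.val : ℤ) : ZMod d) := by push_cast; simp
  rw [AddSubgroup.mem_zmultiples_iff]
  have h2 : x.val % m = c.val % m ↔ (m : ℤ) ∣ x.val - c.val := by
    rw [eq_comm]
    exact Nat.modEq_iff_dvd
  rw [h2, hx]
  constructor
  · rintro ⟨k, hk⟩
    have h3 : ((k * m - (x.val - c.val : ℤ) : ℤ) : ZMod d) = 0 := by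
      push_cast at hk ⊢
      rw [← hk]; simp
    rw [ZMod.intCast_zmod_eq_zero_iff_dvd] at h3
    have h4 := (Int.natCast_dvd_natCast.2 hm).trans h3
    exact (dvd_sub_right (Dvd.intro_left k rfl)).1 h4
  · rintro ⟨k, hk⟩
    exact ⟨k, by rw [hk]; push_cast; simp [mul_comm]⟩
end

lemma aux_vand_choose {n : ℕ} (v : Fin n → ℕ) :
    (vandermonde (fun i => (v i : ℤ))).det =
    (∏ i : Fin n, ((Nat.factorial i : ℕ) : ℤ)) *
      (of fun i j : Fin n => (Nat.choose (v i) j : ℤ)).det := by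
  rw [det_eval_matrixOfPolynomials_eq_det_vandermonde (fun i ↦ (v i : ℤ))
      (fun i => descPochhammer ℤ i)
      (fun i => descPochhammer_natDegree ℤ i)
      (fun i => monic_descPochhammer ℤ i)]
  convert! det_mul_row (fun (i : Fin n) => ((Nat.factorial (i : ℕ)) : ℤ)) _
  rw [of_apply, descPochhammer_eval_eq_descFactorial ℤ _ _]
  norm_cast
  exact Nat.descFactorial_eq_factorial_mul_choose _ _

lemma aux_choose_id (n : ℕ) :
    (of fun i j : Fin n => (Nat.choose (i : ℕ) j : ℤ)).det = 1 := by
  rw [det_of_isLowerTriangular]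
  · simp
  · intro i j hij
    simp only [of_apply, Nat.cast_eq_zero]
    exact Nat.choose_eq_zero_of_lt (by simpa using hij)

/-- number of ordered congruent pairs for a balanced sequence -/
lemma aux_pairs {L : ℕ} (v : Fin L → ℕ) (m : ℕ) (hm : 0 < m)
    (h : ∀ r < m, (Finset.univ.filter fun a => v a % m = r).card = L / m ∨
      (Finset.univ.filter fun a => v a % m = r).card = L / m + 1) :
    ((∑ i, (Finset.univ.filter fun a => v a % m = v i % m).card : ℕ) : ℤ) =
      (2 * (L / m : ℕ) + 1) * L - m * ((L / m : ℕ) * ((L / m : ℕ) + 1)) := by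
  set q := L / m
  have h1 : (∑ i, (Finset.univ.filter fun a => v a % m = v i % m).card : ℕ) =
      ∑ r ∈ Finset.range m, (Finset.univ.filter fun a => v a % m = r).card *
        (Finset.univ.filter fun a => v a % m = r).card := by
    rw [← Finset.sum_fiberwise_of_maps_to (s := Finset.univ) (t := Finset.range m)
      (g := fun i => v i % m) (fun i _ => by simpa using Nat.mod_lt _ hm)]
    refine Finset.sum_congr rfl fun r _ => ?_
    rw [Finset.sum_congr rfl (g := fun _ => (Finset.univ.filter fun a => v a % m = r).card)]
    · simp
    · intro i hi
      simp only [Finset.mem_filter, Finset.mem_univ, true_and] at hi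
      rw [hi]
  have h2 : (L : ℤ) = ∑ r ∈ Finset.range m,
      ((Finset.univ.filter fun a => v a % m = r).card : ℤ) := by
    have := Finset.card_eq_sum_card_fiberwise (s := (Finset.univ : Finset (Fin L)))
      (t := Finset.range m) (f := fun i => v i % m) (fun i _ => by simpa using Nat.mod_lt _ hm)
    simp only [Finset.card_univ, Fintype.card_fin] at this
    exact_mod_cast this
  rw [h1]
  have h3 : ∀ r ∈ Finset.range m, (((Finset.univ.filter fun a => v a % m = r).card *
        (Finset.univ.filter fun a => v a % m = r).card : ℕ) : ℤ) =
        (2 * q + 1) * ((Finset.univ.filter fun a => v a % m = r).card : ℤ) - q * (q + 1) := by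
    intro r hr
    rcases h r (by simpa using hr) with h | h <;> rw [h] <;> push_cast <;> ring
  rw [Nat.cast_sum, Finset.sum_congr rfl h3, Finset.sum_sub_distrib, ← Finset.mul_sum, ← h2]
  simp

lemma aux_val {p M : ℕ} (hp : p.Prime) {n : ℕ} (hn : n ≠ 0) (hlt : n < p ^ M) :
    n.factorization p = ∑ k ∈ Finset.Ico 1 M, if p ^ k ∣ n then 1 else 0 := by
  have h := Nat.emultiplicity_eq_card_pow_dvd (m := p) hp.ne_one (Nat.pos_of_ne_zero hn)
    (Nat.log_lt_of_lt_pow hn hlt)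
  rw [← Finset.card_filter]
  have h2 := Nat.factorization_def n hp
  have := Fact.mk hp
  rw [h2]
  have := padicValNat_eq_emultiplicity (p := p) hn
  rw [h] at this
  exact_mod_cast this

lemma aux_vand_val {p M : ℕ} (hp : p.Prime) {L : ℕ} (v : Fin L → ℕ)
    (hinj : Function.Injective v) (hlt : ∀ i, v i < p ^ M) :
    2 * ((vandermonde (fun i => (v i : ℤ))).det.natAbs.factorization p) + L * (M - 1) =
      ∑ k ∈ Finset.Ico 1 M, ∑ i, (Finset.univ.filter fun a => v a % p ^ k = v i % p ^ k).card := by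
  have h1 : (vandermonde (fun i => (v i : ℤ))).det.natAbs ^ 2 =
      ∏ i, ∏ j ∈ ({i}ᶜ : Finset (Fin L)), ((v j : ℤ) - v i).natAbs := by
    rw [← Finset.prod_prod_Ioi_mul_eq_prod_prod_off_diag (fun j i => ((v j : ℤ) - v i).natAbs),
      det_vandermonde]
    simp only [Finset.prod_mul_distrib, sq]
    rw [← Int.natAbsHom_apply]
    simp only [map_prod, Int.natAbsHom_apply]
    congr 1
    refine Finset.prod_congr rfl fun i _ => Finset.prod_congr rfl fun j _ => ?_
    omega
  have hne : ∀ i, ∀ j ∈ ({i}ᶜ : Finset (Fin L)), ((v j : ℤ) - v i).natAbs ≠ 0 := by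
    intro i j hj
    simp only [Finset.mem_compl, Finset.mem_singleton] at hj
    rw [Int.natAbs_ne_zero, sub_ne_zero]
    exact fun h => hj (hinj (by exact_mod_cast h))
  have h2 := congrArg (fun n => n.factorization p) h1
  simp only [Nat.factorization_pow] at h2
  rw [Nat.factorization_prod (fun i _ => Finset.prod_ne_zero_iff.2 (hne i))] at h2
  simp only [Finsupp.coe_smul, Pi.smul_apply, smul_eq_mul, Finsupp.coe_finsetSum,
    Finset.sum_apply] at h2
  rw [h2]
  have h3 : ∀ i, (∏ j ∈ ({i}ᶜ : Finset (Fin L)), ((v j : ℤ) - v i).natAbs).factorization p =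
      ∑ k ∈ Finset.Ico 1 M, ∑ j ∈ ({i}ᶜ : Finset (Fin L)),
        if v j % p ^ k = v i % p ^ k then 1 else 0 := by
    intro i
    rw [Nat.factorization_prod (hne i), Finset.sum_comm, Finsupp.finsetSum_apply]
    refine Finset.sum_congr rfl fun j hj => ?_
    rw [aux_val hp (hne i j hj) (M := M) (by have := hlt i; have := hlt j; omega)]
    refine Finset.sum_congr rfl fun k _ => ?_
    congr 1
    rw [← Int.natCast_dvd]
    have := (Nat.modEq_iff_dvd (n := p ^ k) (a := v i) (b := v j))
    rw [← this, Nat.ModEq]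
    exact propext eq_comm
  simp only [h3]
  rw [Finset.sum_comm]
  have : L * (M - 1) = ∑ k ∈ Finset.Ico 1 M, ∑ i : Fin L, 1 := by simp [mul_comm]
  rw [this, ← Finset.sum_add_distrib]
  refine Finset.sum_congr rfl fun k _ => ?_
  rw [← Finset.sum_add_distrib]
  refine Finset.sum_congr rfl fun i _ => ?_
  rw [Finset.card_filter, ← Finset.sum_compl_add_sum {i}, Finset.sum_singleton]
  simp

lemma aux_id_balanced (L m r : ℕ) (hm : 0 < m) (hr : r < m) :
    (Finset.univ.filter fun a : Fin L => (a : ℕ) % m = r).card = L / m ∨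
      (Finset.univ.filter fun a : Fin L => (a : ℕ) % m = r).card = L / m + 1 := by
  have h := Nat.count_modEq_card (b := L) (r := m) hm r
  have h2 : (Finset.univ.filter fun a : Fin L => (a : ℕ) % m = r).card =
      L.count (· ≡ r [MOD m]) := by
    rw [Nat.count_eq_card_filter_range]
    refine Finset.card_bij (fun a _ => (a : ℕ)) ?_ ?_ ?_
    · intro a ha
      simp only [Finset.mem_filter, Finset.mem_univ, true_and, Finset.mem_range] at ha ⊢
      exact ⟨a.2, by rw [Nat.ModEq, ha, Nat.mod_eq_of_lt hr]⟩
    · intro a _ b _ hab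
      exact Fin.ext hab
    · intro b hb
      simp only [Finset.mem_filter, Finset.mem_range, Nat.ModEq, Nat.mod_eq_of_lt hr] at hb
      exact ⟨⟨b, hb.1⟩, by simpa using hb.2, rfl⟩
  rw [h2, h]
  split_ifs <;> simp

lemma aux_choose_det {p M : ℕ} (hp : p.Prime) {L : ℕ} (v : Fin L → ℕ)
    (hinj : Function.Injective v) (hlt : ∀ i, v i < p ^ M) (hL : L ≤ p ^ M)
    (h : ∀ k, k ≤ M → ∀ r < p ^ k,
      (Finset.univ.filter fun a => v a % p ^ k = r).card = L / p ^ k ∨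
      (Finset.univ.filter fun a => v a % p ^ k = r).card = L / p ^ k + 1) :
    ¬ (p : ℤ) ∣ (of fun i j : Fin L => (Nat.choose (v i) j : ℤ)).det := by
  have e1 := aux_vand_val hp v hinj hlt
  have e2 := aux_vand_val (M := M) hp (fun i : Fin L => (i : ℕ)) Fin.val_injective
    (fun i => i.2.trans_le hL)
  have e3 : ∑ k ∈ Finset.Ico 1 M, ∑ i, (Finset.univ.filter fun a => v a % p ^ k = v i % p ^ k).card
      = ∑ k ∈ Finset.Ico 1 M, ∑ i : Fin L,
        (Finset.univ.filter fun a : Fin L => (a : ℕ) % p ^ k = (i : ℕ) % p ^ k).card := by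
    refine Finset.sum_congr rfl fun k hk => ?_
    have a1 := aux_pairs v (p ^ k) (pow_pos hp.pos k)
      (h k (by simp only [Finset.mem_Ico] at hk; omega))
    have a2 := aux_pairs (fun i : Fin L => (i : ℕ)) (p ^ k) (pow_pos hp.pos k)
      (fun r hr => aux_id_balanced L (p ^ k) r (pow_pos hp.pos k) hr)
    rw [← a2] at a1
    exact_mod_cast a1
  rw [e3, ← e2] at e1
  have hV : (vandermonde (fun i => (v i : ℤ))).det ≠ 0 := by
    rw [det_vandermonde_ne_zero_iff]
    intro a b hab
    simp only [Nat.cast_inj] at hab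
    exact hinj hab
  rw [aux_vand_choose] at hV e1
  rw [aux_vand_choose (fun i : Fin L => (i : ℕ)), aux_choose_id] at e1
  obtain ⟨hK, hC⟩ := mul_ne_zero_iff.1 hV
  rw [mul_one, Int.natAbs_mul, Nat.factorization_mul (by simpa using hK) (by simpa using hC)] at e1
  simp only [Finsupp.coe_add, Pi.add_apply] at e1
  have e4 : (of fun i j : Fin L => (Nat.choose (v i) j : ℤ)).det.natAbs.factorization p = 0 := by
    omega
  intro hdvd
  rw [Int.natCast_dvd] at hdvd
  have := hp.factorization_pos_of_dvd (Int.natAbs_ne_zero.2 hC) hdvd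
  omega
section
open Polynomial

lemma aux_minor {p M : ℕ} (hp : p.Prime) (hM : 0 < M) {L : ℕ} (v s : Fin L → ℕ)
    (hs : Function.Injective s) (hslt : ∀ i, s i < p ^ M)
    {ω : ℂ} (hω : IsPrimitiveRoot ω (p ^ M))
    (hdet : ¬ (p : ℤ) ∣ (of fun i j : Fin L => (Nat.choose (v i) j : ℤ)).det) :
    (of fun j i : Fin L => ω ^ (s j * v i)).det ≠ 0 := by
  -- polynomials over `ℤ[X]`
  let g : Fin L → ℤ[X] := fun j => X ^ (s j) - 1
  let Q : ℤ[X][X] := ∏ j, (X - C (g j))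
  have hQm : Q.Monic := monic_prod_of_monic _ _ fun j _ => monic_X_sub_C _
  have hQd : Q.natDegree = L := by
    simp [Q, natDegree_prod_of_monic _ _ (fun j _ => monic_X_sub_C (g j))]
  let R : Fin L → ℤ[X][X] := fun i => ((1 + X) ^ (v i)) %ₘ Q
  have hRd : ∀ i, (R i).degree < (L : ℕ) := by
    intro i
    have := degree_modByMonic_lt ((1 + X) ^ (v i)) hQm
    rwa [degree_eq_natDegree hQm.ne_zero, hQd] at this
  have hReval : ∀ i j, (X : ℤ[X]) ^ (s j * v i) = ∑ k : Fin L, g j ^ (k : ℕ) * (R i).coeff k := by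
    intro i j
    have h1 := modByMonic_add_div ((1 + X : ℤ[X][X]) ^ (v i)) Q
    have h2 := congrArg (eval (g j)) h1
    have h3 : eval (g j) Q = 0 := by
      simp only [Q, eval_prod]
      exact Finset.prod_eq_zero (Finset.mem_univ j) (by simp)
    rw [eval_add, eval_mul, h3, zero_mul, add_zero] at h2
    have h4 : eval (g j) ((1 + X : ℤ[X][X]) ^ (v i)) = X ^ (s j * v i) := by
      simp [g, pow_mul]
    rw [h4] at h2
    have hnd : (R i).natDegree < L := by
      by_cases h0 : R i = 0
      · rw [h0, natDegree_zero]
        exact i.pos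
      · exact (natDegree_lt_iff_degree_lt h0).2 (hRd i)
    rw [← h2]
    change eval (g j) (R i) = _
    rw [eval_eq_sum_range' hnd, ← Fin.sum_univ_eq_sum_range (fun k => (R i).coeff k * g j ^ k)]
    exact Finset.sum_congr rfl fun k _ => mul_comm _ _
  let B : Matrix (Fin L) (Fin L) ℤ[X] := of fun k i => (R i).coeff k
  have hfac : (of fun j i : Fin L => (X : ℤ[X]) ^ (s j * v i)) = vandermonde g * B := by
    ext1 j i
    simp only [of_apply, mul_apply, vandermonde_apply, B, hReval i j]
  -- evaluation at `ω`
  have hfac2 : (of fun j i : Fin L => ω ^ (s j * v i)).det =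
      (vandermonde fun j => ω ^ (s j) - 1).det * aeval ω B.det := by
    have h := congrArg (fun N => aeval ω (det N)) hfac
    simp only [det_mul, map_mul] at h
    rw [AlgHom.map_det, AlgHom.map_det] at h
    convert! h using 3
    · ext j i
      simp
    · ext j i
      simp [g, vandermonde_apply]
  rw [hfac2]
  refine mul_ne_zero ?_ ?_
  · rw [det_vandermonde_ne_zero_iff]
    intro a b hab
    simp only [sub_left_inj] at hab
    exact hs (hω.pow_inj (hslt a) (hslt b) hab)
  · intro h0
    have hpos : 0 < p ^ M := pow_pos hp.pos M
    have hd : cyclotomic (p ^ M) ℤ ∣ B.det := by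
      rw [cyclotomic_eq_minpoly hω hpos]
      exact minpoly.isIntegrallyClosed_dvd (hω.isIntegral hpos) h0
    have hd2 : (p : ℤ) ∣ eval 1 B.det := by
      obtain ⟨k, rfl⟩ : ∃ k, M = k + 1 := ⟨M - 1, by omega⟩
      have := Fact.mk hp
      rw [← eval_one_cyclotomic_prime_pow (R := ℤ) k (p := p)]
      exact eval_dvd hd
    apply hdet
    convert! hd2 using 1
    rw [← coe_evalRingHom, RingHom.map_det, ← det_transpose]
    congr 1
    ext k i
    simp only [transpose_apply, of_apply, RingHom.mapMatrix_apply, map_apply, B]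
    have h5 : (R i).map (evalRingHom 1) = ((1 + X : ℤ[X]) ^ (v i)) %ₘ (X ^ L) := by
      simp only [R]
      rw [map_modByMonic _ hQm]
      congr 1
      · simp
      · simp [Q, Polynomial.map_prod, g]
    rw [← coeff_map, h5]
    have h6 := congrArg (fun P => coeff P (k : ℕ))
      (modByMonic_add_div ((1 + X : ℤ[X]) ^ (v i)) (X ^ L))
    simp only [coeff_add, coeff_X_pow_mul', if_neg (not_le.2 k.2), add_zero,
      coeff_one_add_X_pow] at h6
    exact h6.symm
end
section
variable {d : ℕ} [NeZero d]

lemma unif_minor (hd : IsPrimePow d) (Ω : Finset (ZMod d)) (hU : UnifDist d Ω)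
    (S : Finset (ZMod d)) (hS : S.card = Ω.card) (u : ZMod d → ℂ) (hu : ∀ j ∉ S, u j = 0)
    (h : ∀ i ∈ Ω, ∑ j, chiD d (j * i) * u j = 0) : u = 0 := by
  classical
  obtain ⟨p, M, hp, hM, rfl⟩ := (isPrimePow_nat_iff d).1 hd
  set L := Ω.card with hL
  let eΩ := Ω.equivFinOfCardEq hL.symm
  let eS := S.equivFinOfCardEq hS
  let v : Fin L → ℕ := fun a => ((eΩ.symm a : Ω) : ZMod (p ^ M)).val
  let s : Fin L → ℕ := fun a => ((eS.symm a : S) : ZMod (p ^ M)).val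
  have hv : Function.Injective v := fun a b hab =>
    eΩ.symm.injective (Subtype.ext (ZMod.val_injective _ hab))
  have hs : Function.Injective s := fun a b hab =>
    eS.symm.injective (Subtype.ext (ZMod.val_injective _ hab))
  have hLd : L ≤ p ^ M := by
    have := Finset.card_le_univ Ω
    rwa [ZMod.card] at this
  have hbal : ∀ k, k ≤ M → ∀ r < p ^ k,
      (Finset.univ.filter fun a => v a % p ^ k = r).card = L / p ^ k ∨
      (Finset.univ.filter fun a => v a % p ^ k = r).card = L / p ^ k + 1 := by
    intro k hk r hr
    have hm : p ^ k ∣ p ^ M := pow_dvd_pow p hk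
    have hmpos : 0 < p ^ k := pow_pos hp.pos k
    have hrv : ((r : ZMod (p ^ M))).val = r :=
      ZMod.val_cast_of_lt (hr.trans_le (Nat.le_of_dvd (pow_pos hp.pos M) hm))
    have hcard : (Finset.univ.filter fun a => v a % p ^ k = r).card =
        {x : ZMod (p ^ M) | x ∈ Ω ∧ x - (r : ZMod (p ^ M)) ∈
          AddSubgroup.zmultiples ((p ^ k : ℕ) : ZMod (p ^ M))}.ncard := by
      have : {x : ZMod (p ^ M) | x ∈ Ω ∧ x - (r : ZMod (p ^ M)) ∈
          AddSubgroup.zmultiples ((p ^ k : ℕ) : ZMod (p ^ M))} =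
          ((Ω.filter fun x => x.val % p ^ k = r : Finset (ZMod (p ^ M))) :
            Set (ZMod (p ^ M))) := by
        ext x
        simp only [Set.mem_ofPred_eq, mem_zmult_iff hm, hrv, Nat.mod_eq_of_lt hr,
          Finset.coe_filter]
      rw [this, Set.ncard_coe_finset]
      refine Finset.card_bij (fun a _ => ((eΩ.symm a : Ω) : ZMod (p ^ M))) ?_ ?_ ?_
      · intro a ha
        simp only [Finset.mem_filter, Finset.mem_univ, true_and] at ha ⊢
        exact ⟨(eΩ.symm a).2, ha⟩
      · intro a _ b _ hab
        exact eΩ.symm.injective (Subtype.ext hab)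
      · intro x hx
        simp only [Finset.mem_filter] at hx
        exact ⟨eΩ ⟨x, hx.1⟩, by simpa [v] using hx.2, by simp⟩
    rw [hcard]
    rcases hU (p ^ k) hm r with h1 | h1
    · exact Or.inl h1
    · rw [h1, ← hL]
      have h2 : (L + p ^ k - 1) / p ^ k ≤ (L + p ^ k) / p ^ k := Nat.div_le_div_right (by omega)
      have h3 : L / p ^ k ≤ (L + p ^ k - 1) / p ^ k := Nat.div_le_div_right (by omega)
      rw [Nat.add_div_right _ hmpos] at h2
      omega
  have hdet := aux_choose_det hp v hv (fun i => ZMod.val_lt _) hLd hbal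
  have hmin := aux_minor hp hM v s hs (fun i => ZMod.val_lt _) (chiD_one_prim (d := p ^ M)) hdet
  have hz := eq_zero_of_vecMul_eq_zero (v := fun a => u ((eS.symm a : S) : ZMod (p ^ M))) hmin (by
    ext b
    have hb := h _ (eΩ.symm b).2
    rw [← Finset.sum_subset (Finset.subset_univ S)
      (fun j _ hj => by rw [hu j hj, mul_zero]), ← Finset.sum_coe_sort, ← eS.symm.sum_comp] at hb
    simp only [vecMul, dotProduct, of_apply, Pi.zero_apply]
    rw [← hb]
    refine Finset.sum_congr rfl fun a _ => ?_
    rw [mul_comm, ← chiD_nat_mul]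
    simp [s, v])
  ext j
  by_cases hj : j ∈ S
  · have := congrFun hz (eS ⟨j, hj⟩)
    simpa using this
  · exact hu j hj

lemma unif_frame (hd : IsPrimePow d) (Ω : Finset (ZMod d)) (hU : UnifDist d Ω)
    (b : ZMod d → ℂ) (hb : maxMult d b = Ω.card) (u : ZMod d → ℂ)
    (h : ∀ i ∈ Ω, ∀ n < numEig d b, ∑ j, chiD d (j * i) * (b j ^ n * u j) = 0) : u = 0 := by
  classical
  have hN : numEig d b = (Finset.univ.image b).card := by
    rw [numEig, Nat.card_coe_set_eq, ← Set.image_univ, ← Finset.coe_univ, ← Finset.coe_image,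
      Set.ncard_coe_finset]
  have hpoly : ∀ P : Polynomial ℂ, P.natDegree < numEig d b → ∀ i ∈ Ω,
      ∑ j, chiD d (j * i) * (P.eval (b j) * u j) = 0 := by
    intro P hP i hi
    have : ∀ j, chiD d (j * i) * (P.eval (b j) * u j) =
        ∑ n ∈ Finset.range (numEig d b), P.coeff n * (chiD d (j * i) * (b j ^ n * u j)) := by
      intro j
      rw [Polynomial.eval_eq_sum_range' hP, Finset.sum_mul, Finset.mul_sum]
      exact Finset.sum_congr rfl fun n _ => by ring
    simp only [this]
    rw [Finset.sum_comm]
    refine Finset.sum_eq_zero fun n hn => ?_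
    rw [← Finset.mul_sum, h i hi n (by simpa using hn), mul_zero]
  ext j₀
  let S : Finset (ZMod d) := Finset.univ.filter fun t => b t = b j₀
  have hSc : S.card ≤ Ω.card := by
    rw [← hb, maxMult]
    have := Finset.le_sup (f := fun j : ZMod d => Nat.card {t : ZMod d | b t = b j})
      (Finset.mem_univ j₀)
    refine le_trans (le_of_eq ?_) this
    simp only [S]
    rw [Nat.card_coe_set_eq, ← Set.ncard_coe_finset]
    simp
  obtain ⟨S', hSS, hS'⟩ := Finset.exists_superset_card_eq hSc (Finset.card_le_univ Ω)
  have hj₀ : b j₀ ∈ Finset.univ.image b := Finset.mem_image_of_mem _ (Finset.mem_univ _)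
  have hP := hpoly (Lagrange.basis (Finset.univ.image b) id (b j₀)) (by
    rw [Lagrange.natDegree_basis (Set.injOn_id _) hj₀, hN]
    have := Finset.card_pos.2 ⟨_, hj₀⟩
    omega)
  have hev : ∀ j, (Lagrange.basis (Finset.univ.image b) id (b j₀)).eval (b j) =
      if j ∈ S then 1 else 0 := by
    intro j
    by_cases hj : b j = b j₀
    · rw [if_pos (by simpa [S] using hj), hj]
      exact Lagrange.eval_basis_self (v := id) (Set.injOn_id _) hj₀
    · rw [if_neg (by simpa [S] using hj)]
      exact Lagrange.eval_basis_of_ne (v := id) (Ne.symm hj)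
        (Finset.mem_image_of_mem _ (Finset.mem_univ _))
  have hz := unif_minor hd Ω hU S' hS' (fun j => if j ∈ S then u j else 0)
    (fun j hj => if_neg fun hj' => hj (hSS hj')) (fun i hi => by
      refine Eq.trans (Finset.sum_congr rfl fun j _ => ?_) (hP i hi)
      rw [hev]
      split_ifs <;> simp)
  have := congrFun hz j₀
  simpa [S] using this

lemma sum_blocks (f : ℕ → ℂ) (m e : ℕ) :
    ∑ x ∈ Finset.range (m * e), f x =
      ∑ s ∈ Finset.range m, ∑ t ∈ Finset.range e, f (s * e + t) := by
  induction m with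
  | zero => simp
  | succ m ih => rw [Finset.sum_range_succ, ← ih, add_mul, one_mul, Finset.sum_range_add]

lemma sum_zmod (f : ℕ → ℂ) : ∑ j : ZMod d, f j.val = ∑ x ∈ Finset.range d, f x := by
  refine Finset.sum_bij (fun j _ => j.val) ?_ ?_ ?_ ?_
  · intro j _; simpa using ZMod.val_lt j
  · intro a _ b _ hab; exact ZMod.val_injective _ hab
  · intro x hx
    exact ⟨(x : ZMod d), Finset.mem_univ _, ZMod.val_cast_of_lt (by simpa using hx)⟩
  · intro j _; rfl

lemma card_block {m e : ℕ} (hd : d = m * e) (q : ℕ) (hq : q ≤ e) :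
    (Finset.univ.filter fun j : ZMod d => j.val % e < q).card = m * q := by
  have h : ((Finset.univ.filter fun j : ZMod d => j.val % e < q).card : ℂ) = (m * q : ℕ) := by
    rw [Finset.card_filter]
    push_cast
    rw [sum_zmod (fun x => if x % e < q then (1 : ℂ) else 0)]
    rw [hd, sum_blocks]
    have : ∀ s ∈ Finset.range m, ∑ t ∈ Finset.range e,
        (if (s * e + t) % e < q then (1 : ℂ) else 0) = q := by
      intro s _
      rw [Finset.sum_congr rfl (g := fun t => if t < q then (1 : ℂ) else 0)]
      · rw [← Finset.sum_filter]
        have : (Finset.range e).filter (fun t => t < q) = Finset.range q := by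
          ext t; simp only [Finset.mem_filter, Finset.mem_range]; omega
        rw [this]; simp
      · intro t ht
        rw [Nat.mul_add_mod_self_right, Nat.mod_eq_of_lt (by simpa using ht)]
    rw [Finset.sum_congr rfl this]
    simp
  exact_mod_cast h

lemma mul_sub_eq_zero_iff {m e : ℕ} (hd : d = m * e) (x c : ZMod d) :
    (e : ZMod d) * (x - c) = 0 ↔ x - c ∈ AddSubgroup.zmultiples ((m : ZMod d)) := by
  have hpos : 0 < d := NeZero.pos d
  have he : (e : ℤ) ≠ 0 := by
    rintro h
    have : e = 0 := by exact_mod_cast h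
    subst this; omega
  rw [mem_zmult_iff ⟨e, hd⟩]
  have hx : (e : ZMod d) * (x - c) = ((e * (x.val - c.val) : ℤ) : ZMod d) := by push_cast; simp
  have h2 : x.val % m = c.val % m ↔ (m : ℤ) ∣ x.val - c.val := by
    rw [eq_comm]
    exact Nat.modEq_iff_dvd
  rw [h2, hx, ZMod.intCast_zmod_eq_zero_iff_dvd]
  have : (d : ℤ) = e * m := by rw [hd]; push_cast; ring
  rw [this, mul_dvd_mul_iff_left he]

lemma caseA {m e : ℕ} (hd : d = m * e) (Ω W : Finset (ZMod d)) (c : ZMod d) (q : ℕ)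
    (hW : ∀ i, i ∈ W ↔ i ∈ Ω ∧ i - c ∈ AddSubgroup.zmultiples ((m : ZMod d)))
    (hq : m * q ≤ Ω.card) (hqe : q ≤ e) (hn : W.card < q) :
    ∃ S : Finset (ZMod d), S.card = Ω.card ∧ ∃ u : ZMod d → ℂ, u ≠ 0 ∧ (∀ j ∉ S, u j = 0) ∧
      ∀ i ∈ Ω, ∑ j, chiD d (j * i) * u j = 0 := by
  classical
  have hpos : 0 < d := NeZero.pos d
  let T : (Fin q → ℂ) →ₗ[ℂ] (W → ℂ) :=
    Matrix.toLin' (of fun (i : W) (t : Fin q) => chiD d (((t : ℕ) : ZMod d) * (i : ZMod d)))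
  have hker : LinearMap.ker T ≠ ⊥ := LinearMap.ker_ne_bot_of_finrank_lt (by simpa using hn)
  obtain ⟨y, hy, hy0⟩ := (Submodule.ne_bot_iff _).1 hker
  let Y : ℕ → ℂ := fun t => if h : t < q then y ⟨t, h⟩ else 0
  have hY : ∀ i ∈ W, ∑ t ∈ Finset.range e, chiD d ((t : ZMod d) * i) * Y t = 0 := by
    intro i hi
    have h1 := congrFun (LinearMap.mem_ker.1 hy) ⟨i, hi⟩
    simp only [T, toLin'_apply, mulVec, dotProduct, of_apply, Pi.zero_apply] at h1
    rw [← Finset.sum_subset (Finset.range_subset_range.2 hqe), ← h1,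
      ← Fin.sum_univ_eq_sum_range (fun t => chiD d ((t : ZMod d) * i) * Y t)]
    · exact Finset.sum_congr rfl fun t _ => by simp [Y]
    · intro t _ ht
      have : ¬ t < q := by simpa using ht
      simp [Y, this]
  let U : ℕ → ℂ := fun x => Y (x % e) * chiD d (((x / e : ℕ) : ZMod d) * (-(e * c)))
  obtain ⟨S, hS1, hS2⟩ := Finset.exists_superset_card_eq
    (s := Finset.univ.filter fun j : ZMod d => j.val % e < q) (n := Ω.card)
    (by rw [card_block hd q hqe]; exact hq) (Finset.card_le_univ Ω)
  have hepos : 0 < e := by omega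
  refine ⟨S, hS2, fun j => U j.val, ?_, ?_, ?_⟩
  · intro h0
    apply hy0
    ext t
    have hte : (t : ℕ) < e := t.2.trans_le hqe
    have hed : e ≤ d := Nat.le_of_dvd hpos ⟨m, by rw [hd, mul_comm]⟩
    have h1 := congrFun h0 ((t : ℕ) : ZMod d)
    simp only [U, ZMod.val_cast_of_lt (hte.trans_le hed), Nat.mod_eq_of_lt hte,
      Nat.div_eq_of_lt hte, Pi.zero_apply] at h1
    simpa [chiD_zero, Y] using h1
  · intro j hj
    have : ¬ j.val % e < q := fun h => hj (hS1 (by simpa using h))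
    simp [U, Y, this]
  · intro i hi
    have h1 : ∀ j : ZMod d, chiD d (j * i) * U j.val =
        (fun x : ℕ => chiD d ((x : ZMod d) * i) * U x) j.val := by
      intro j; simp
    rw [Finset.sum_congr rfl (fun j _ => h1 j),
      sum_zmod (fun x : ℕ => chiD d ((x : ZMod d) * i) * U x)]
    have h2 : ∑ x ∈ Finset.range d, chiD d ((x : ZMod d) * i) * U x =
        (∑ s ∈ Finset.range m, chiD d (e * (i - c)) ^ s) *
          ∑ t ∈ Finset.range e, chiD d ((t : ZMod d) * i) * Y t := by
      have : Finset.range d = Finset.range (m * e) := by rw [← hd]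
      rw [this, sum_blocks, Finset.sum_mul_sum]
      refine Finset.sum_congr rfl fun s _ => Finset.sum_congr rfl fun t ht => ?_
      have hte : t < e := by simpa using ht
      simp only [U]
      rw [Nat.mul_add_mod_self_right, Nat.mod_eq_of_lt hte, mul_comm s e,
        Nat.mul_add_div hepos, Nat.div_eq_of_lt hte, add_zero, ← chiD_nat_mul]
      have : chiD d ((s : ZMod d) * (e * (i - c))) * chiD d ((t : ZMod d) * i) =
          chiD d (((e * s + t : ℕ) : ZMod d) * i) * chiD d ((s : ZMod d) * (-(e * c))) := by
        rw [← chiD_add, ← chiD_add]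
        congr 1
        push_cast
        ring
      linear_combination (-Y t) * this
    rw [h2]
    by_cases hic : i - c ∈ AddSubgroup.zmultiples ((m : ZMod d))
    · rw [hY i ((hW i).2 ⟨hi, hic⟩), mul_zero]
    · have hne : chiD d (e * (i - c)) ≠ 1 := by
        rw [Ne, chiD_eq_one, mul_sub_eq_zero_iff hd]
        exact hic
      have hone : chiD d (e * (i - c)) ^ m = 1 := by
        rw [← chiD_nat_mul, ← mul_assoc, ← Nat.cast_mul, ← hd]
        simp [chiD_zero]
      rw [geom_sum_eq hne, hone]
      simp

lemma caseB {m e : ℕ} (hd : d = m * e) (Ω W : Finset (ZMod d)) (c : ZMod d) (q : ℕ)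
    (hW : ∀ i, i ∈ W ↔ i ∈ Ω ∧ i - c ∈ AddSubgroup.zmultiples ((m : ZMod d)))
    (hq : Ω.card ≤ m * q) (hqe : q ≤ e) (hn : q < W.card) :
    ∃ S : Finset (ZMod d), S.card = Ω.card ∧ ∃ u : ZMod d → ℂ, u ≠ 0 ∧ (∀ j ∉ S, u j = 0) ∧
      ∀ i ∈ Ω, ∑ j, chiD d (j * i) * u j = 0 := by
  classical
  obtain ⟨S, hS1, hS2⟩ := Finset.exists_subset_card_eq
    (s := Finset.univ.filter fun j : ZMod d => j.val % e < q) (n := Ω.card)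
    (by rw [card_block hd q hqe]; exact hq)
  let T : (W → ℂ) →ₗ[ℂ] (Fin q → ℂ) :=
    Matrix.toLin' (of fun (t : Fin q) (i : W) => chiD d (((t : ℕ) : ZMod d) * (i : ZMod d)))
  have hker : LinearMap.ker T ≠ ⊥ := LinearMap.ker_ne_bot_of_finrank_lt (by simpa using hn)
  obtain ⟨z, hz, hz0⟩ := (Submodule.ne_bot_iff _).1 hker
  have hzS : ∀ j ∈ S, ∑ i : W, chiD d (j * i) * z i = 0 := by
    intro j hj
    have hjq : j.val % e < q := by simpa using hS1 hj
    have h1 := congrFun (LinearMap.mem_ker.1 hz) ⟨j.val % e, hjq⟩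
    simp only [T, toLin'_apply, mulVec, dotProduct, of_apply, Pi.zero_apply] at h1
    have h2 : ∀ i : W, chiD d (j * i) * z i = chiD d (((j.val / e : ℕ) : ZMod d) * (e * c)) *
        (chiD d (((j.val % e : ℕ) : ZMod d) * i) * z i) := by
      intro i
      rw [← mul_assoc, ← chiD_add]
      congr 2
      have h3 := (mul_sub_eq_zero_iff hd (i : ZMod d) c).2 ((hW i).1 i.2).2
      have h4 : j = e * ((j.val / e : ℕ) : ZMod d) + ((j.val % e : ℕ) : ZMod d) := by
        rw [← Nat.cast_mul, ← Nat.cast_add, Nat.div_add_mod]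
        simp
      conv_lhs => rw [h4]
      linear_combination ((j.val / e : ℕ) : ZMod d) * h3
    rw [Finset.sum_congr rfl (fun i _ => h2 i), ← Finset.mul_sum, h1, mul_zero]
  let R : (S → ℂ) →ₗ[ℂ] (Ω → ℂ) :=
    Matrix.toLin' (of fun (i : Ω) (j : S) => chiD d ((j : ZMod d) * (i : ZMod d)))
  have hns : ¬ Function.Injective R := by
    intro hinj
    have hsurj := (LinearMap.injective_iff_surjective_of_finrank_eq_finrank
      (f := R) (by simp [hS2])).1 hinj
    apply hz0
    ext i₀
    obtain ⟨u, hu⟩ := hsurj (Pi.single ⟨i₀, ((hW i₀).1 i₀.2).1⟩ 1)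
    have h1 : ∑ i : W, z i * R u ⟨i, ((hW i).1 i.2).1⟩ = 0 := by
      simp only [R, toLin'_apply, mulVec, dotProduct, of_apply, Finset.mul_sum]
      rw [Finset.sum_comm]
      refine Finset.sum_eq_zero fun j _ => ?_
      have := hzS j j.2
      calc _ = ∑ i : W, u j * (chiD d (j * i) * z i) :=
            Finset.sum_congr rfl fun i _ => by ring
        _ = 0 := by rw [← Finset.mul_sum, this, mul_zero]
    rw [hu, Finset.sum_eq_single i₀] at h1
    · simpa using h1
    · intro i _ hi
      rw [Pi.single_eq_of_ne, mul_zero]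
      intro h
      exact hi (Subtype.ext (congrArg (fun x : Ω => (x : ZMod d)) h))
    · simp
  have hkR : LinearMap.ker R ≠ ⊥ := fun h => hns (LinearMap.ker_eq_bot.1 h)
  obtain ⟨u, hu, hu0⟩ := (Submodule.ne_bot_iff _).1 hkR
  refine ⟨S, hS2, fun j => if h : j ∈ S then u ⟨j, h⟩ else 0, ?_, ?_, ?_⟩
  · intro h0
    apply hu0
    ext j
    have := congrFun h0 j
    simpa using this
  · intro j hj
    simp [hj]
  · intro i hi
    have h1 := congrFun (LinearMap.mem_ker.1 hu) ⟨i, hi⟩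
    simp only [R, toLin'_apply, mulVec, dotProduct, of_apply, Pi.zero_apply] at h1
    rw [← Finset.sum_subset (Finset.subset_univ S), ← Finset.sum_coe_sort, ← h1]
    · exact Finset.sum_congr rfl fun j _ => by simp
    · intro j _ hj
      simp [hj]

lemma not_unif (Ω : Finset (ZMod d)) (hU : ¬ UnifDist d Ω) : 0 < Ω.card ∧
    ∃ S : Finset (ZMod d), S.card = Ω.card ∧ ∃ u : ZMod d → ℂ, u ≠ 0 ∧ (∀ j ∉ S, u j = 0) ∧
      ∀ i ∈ Ω, ∑ j, chiD d (j * i) * u j = 0 := by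
  classical
  rw [UnifDist] at hU
  push Not at hU
  obtain ⟨m, hm, c, h1, h2⟩ := hU
  obtain ⟨e, hd⟩ := hm
  have hpos : 0 < d := NeZero.pos d
  have hmpos : 0 < m := Nat.pos_of_ne_zero (by rintro rfl; omega)
  let W : Finset (ZMod d) :=
    Ω.filter fun x => x - c ∈ AddSubgroup.zmultiples ((m : ZMod d))
  have hW : ∀ i, i ∈ W ↔ i ∈ Ω ∧ i - c ∈ AddSubgroup.zmultiples ((m : ZMod d)) := by
    intro i; simp [W]
  have hset : {x : ZMod d | x ∈ Ω ∧ x - c ∈ AddSubgroup.zmultiples ((m : ZMod d))} =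
      (W : Set (ZMod d)) := by
    ext x; simp [W]
  rw [hset, Set.ncard_coe_finset] at h1 h2
  have hWle : W.card ≤ Ω.card := Finset.card_filter_le _ _
  have hLd : Ω.card ≤ m * e := by
    have := Finset.card_le_univ Ω
    rw [ZMod.card] at this
    omega
  have a2 : (Ω.card + m - 1) / m ≤ (Ω.card + m) / m := Nat.div_le_div_right (by omega)
  rw [Nat.add_div_right _ hmpos] at a2
  have a3 : Ω.card / m ≤ (Ω.card + m - 1) / m := Nat.div_le_div_right (by omega)
  have a4 : m * (Ω.card / m) ≤ Ω.card := Nat.mul_div_le _ _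
  have a5 : Ω.card / m ≤ e := Nat.div_le_of_le_mul hLd
  have a6 : Ω.card ≤ m * ((Ω.card + m - 1) / m) := by
    have := Nat.lt_mul_div_succ (Ω.card + m - 1) hmpos
    rw [mul_add, mul_one] at this
    omega
  have a7 : (Ω.card + m - 1) / m ≤ e := by
    refine Nat.lt_succ_iff.1 ((Nat.div_lt_iff_lt_mul hmpos).2 ?_)
    rw [Nat.succ_mul, mul_comm e m]
    omega
  rcases lt_or_ge W.card (Ω.card / m) with h | h
  · refine ⟨?_, caseA hd Ω W c _ hW a4 a5 h⟩
    by_contra h0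
    have : Ω.card = 0 := by omega
    rw [this] at h
    simp at h
  · have h3 : (Ω.card + m - 1) / m < W.card := by omega
    exact ⟨(Nat.zero_le _).trans_lt (h3.trans_le hWle), caseB hd Ω W c _ hW a6 a7 h3⟩

lemma maxMult_example (S : Finset (ZMod d)) (hS : 0 < S.card) :
    maxMult d (fun j => if j ∈ S then 0 else ((j.val : ℂ) + 1)) = S.card := by
  classical
  have hne : ∀ x : ZMod d, ((x.val : ℂ) + 1) ≠ 0 := fun x => Nat.cast_add_one_ne_zero _
  have h1 : ∀ j ∈ S, Nat.card {t : ZMod d | (if t ∈ S then (0 : ℂ) else ((t.val : ℂ) + 1)) =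
      if j ∈ S then 0 else ((j.val : ℂ) + 1)} = S.card := by
    intro j hj
    have : {t : ZMod d | (if t ∈ S then (0 : ℂ) else ((t.val : ℂ) + 1)) =
      if j ∈ S then 0 else ((j.val : ℂ) + 1)} = (S : Set (ZMod d)) := by
      ext t
      by_cases ht : t ∈ S <;> simp [ht, hj, hne, -ZMod.natCast_val]
    rw [this, Nat.card_coe_set_eq, Set.ncard_coe_finset]
  apply le_antisymm
  · refine Finset.sup_le fun j _ => ?_
    by_cases hj : j ∈ S
    · exact (h1 j hj).le
    · have : {t : ZMod d | (if t ∈ S then (0 : ℂ) else ((t.val : ℂ) + 1)) =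
        if j ∈ S then 0 else ((j.val : ℂ) + 1)} = {j} := by
        ext t
        by_cases ht : t ∈ S
        · have : t ≠ j := by rintro rfl; exact hj ht
          simp [ht, hj, (hne j).symm, this, -ZMod.natCast_val]
        · simp [ht, hj, (ZMod.val_injective d).eq_iff, -ZMod.natCast_val]
      rw [this, Nat.card_coe_set_eq, Set.ncard_singleton]
      exact hS
  · obtain ⟨j, hj⟩ := Finset.card_pos.1 hS
    rw [← h1 j hj]
    exact Finset.le_sup (f := fun j => Nat.card {t : ZMod d |
      (if t ∈ S then (0 : ℂ) else ((t.val : ℂ) + 1)) =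
      if j ∈ S then 0 else ((j.val : ℂ) + 1)}) (Finset.mem_univ j)
end

/-- if `d` is a prime power and `|Ω| = L`, then
`Y = {A^n e_i : i ∈ Ω, n ≤ N_A - 1}` is a frame for every circular convolution operator
`A ∈ 𝒜_L` iff `Ω` is uniformly distributed over the divisors of `d`. -/
theorem stmt8 (d : ℕ) [NeZero d] (hd : IsPrimePow d) (L : ℕ) (Ω : Finset (ZMod d))
    (hΩ : Ω.card = L) :
    (∀ a : ZMod d → ℂ, maxMult d (hatKer d a) = L →
      Submodule.span ℂ {v : ZMod d → ℂ | ∃ i ∈ Ω, ∃ n < numEig d (hatKer d a),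
          v = (convMat d a) ^ n *ᵥ (Pi.single i 1 : ZMod d → ℂ)} = ⊤)
    ↔ UnifDist d Ω := by
  subst hΩ
  constructor
  · intro h
    by_contra hU
    obtain ⟨hpos, S, hS, u, hu0, huS, hu⟩ := not_unif Ω hU
    obtain ⟨a, ha⟩ := (ZMod.dft (N := d) (E := ℂ)).surjective
      (fun j => if j ∈ S then 0 else ((j.val : ℂ) + 1))
    have hb : hatKer d a = fun j => if j ∈ S then 0 else ((j.val : ℂ) + 1) := by
      rw [hatKer_eq, ha]
    have h1 := h a (by rw [hb, maxMult_example S (by omega), hS])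
    rw [frame_iff] at h1
    apply hu0
    apply h1
    intro i hi n _
    have h2 : (0 : ℂ) ^ n * ∑ j, chiD d (j * i) * u j = 0 := by rw [hu i hi, mul_zero]
    rw [Finset.mul_sum] at h2
    refine Eq.trans (Finset.sum_congr rfl fun j _ => ?_) h2
    by_cases hj : j ∈ S
    · rw [hb]
      simp only [hj, if_true]
      ring
    · rw [huS j hj]
      simp
  · intro hU a ha
    rw [frame_iff]
    intro u hu
    exact unif_frame hd Ω hU _ ha u hu
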